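/- arXiv:1802.07300 — 3 statements merged into one kernel-verified Lean document; each statement's English description precedes it below -/
import Mathlib

section
/- The adversary's key in the Anshel–Anshel–Goldfeld protocol is correct if and only if the two centralizing elements commute: Let G be a group and let x, y, c_a, c_b ∈ G. Suppose c_b commutes with y (c_b·y = y·c_b) and c_a commutes with x (c_a·x = x·c_a). Then (c_b·x)⁻¹·(c_a·y)⁻¹·(c_b·x)·(c_a·y) = x⁻¹y⁻¹xy if and only if c_a·c_b = c_b·c_a. -/
/-- The adversary's key is the true key with the commutator of the two centralizing elements
inserted in the middle. -/
theorem aag_adversary_key_eq {G : Type*} [Group G] {x y ca cb : G}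
    (hb : Commute cb y) (ha : Commute ca x) :
    (cb * x)⁻¹ * (ca * y)⁻¹ * (cb * x) * (ca * y) =
      x⁻¹ * y⁻¹ * ((ca * cb)⁻¹ * (cb * ca)) * (x * y) :=
  calc
    _ = x⁻¹ * (cb⁻¹ * y⁻¹) * ca⁻¹ * cb * (x * ca) * y := by group
    _ = x⁻¹ * (y⁻¹ * cb⁻¹) * ca⁻¹ * cb * (ca * x) * y := by rw [hb.inv_inv.eq, ha.eq]
    _ = _ := by group

/-- The adversary's key in the AAG protocol is correct iff the two centralizing
elements commute. -/
theorem aag_adversary_key_iff {G : Type*} [Group G] (x y ca cb : G)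
    (hb : cb * y = y * cb) (ha : ca * x = x * ca) :
    (cb * x)⁻¹ * (ca * y)⁻¹ * (cb * x) * (ca * y) = x⁻¹ * y⁻¹ * x * y ↔
      ca * cb = cb * ca := by
  rw [aag_adversary_key_eq hb ha, mul_assoc _ x y, mul_left_inj, mul_eq_left, inv_mul_eq_one]
end

section
/- Commutator identity recovering the left factor in the decomposition problem: Let G be a group and let a, b, a₁, w ∈ G with b·a₁ = a₁·b. Then [(a·w·b)⁻¹, a₁⁻¹] = ((a₁)^{w⁻¹·a⁻¹})·a₁⁻¹ = (((a₁)^{w⁻¹})^{a⁻¹})·a₁⁻¹, where [x, y] = x⁻¹y⁻¹xy and x^y = y⁻¹xy. Consequently, multiplying this commutator on the right by a₁ yields ((a₁)^{w⁻¹})^{a⁻¹}, a conjugate of the known element (a₁)^{w⁻¹} by the unknown a⁻¹. -/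
/-- Commutator identity recovering the left factor in the decomposition problem:
if `b * a₁ = a₁ * b` then `[(a*w*b)⁻¹, a₁⁻¹] = ((a₁)^{w⁻¹*a⁻¹}) * a₁⁻¹
= (((a₁)^{w⁻¹})^{a⁻¹}) * a₁⁻¹`, where `[x,y] = x⁻¹y⁻¹xy` and `x^y = y⁻¹xy`. -/
theorem commutator_recovers_left_factor {G : Type*} [Group G] (a b a₁ w : G)
    (h : b * a₁ = a₁ * b) :
    (a * w * b) * a₁ * (a * w * b)⁻¹ * a₁⁻¹ =
        ((w⁻¹ * a⁻¹)⁻¹ * a₁ * (w⁻¹ * a⁻¹)) * a₁⁻¹ ∧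
      (a * w * b) * a₁ * (a * w * b)⁻¹ * a₁⁻¹ =
        ((a⁻¹)⁻¹ * ((w⁻¹)⁻¹ * a₁ * w⁻¹) * a⁻¹) * a₁⁻¹ := by
  have hb : b * a₁ * b⁻¹ = a₁ := by rw [h, mul_inv_cancel_right]
  have key : (a * w * b) * a₁ * (a * w * b)⁻¹ = a * w * a₁ * w⁻¹ * a⁻¹ := by
    calc (a * w * b) * a₁ * (a * w * b)⁻¹
        = a * w * (b * a₁ * b⁻¹) * w⁻¹ * a⁻¹ := by group
      _ = a * w * a₁ * w⁻¹ * a⁻¹ := by rw [hb]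
  rw [key]
  constructor <;> group
end

section
/- Commutator identity attacking the subgroup-restricted conjugacy search problem: Let G be a group and let a, b, w ∈ G with a·b = b·a. Then [a⁻¹·w·a, b] = ((b⁻¹)^w)^a · b, where [x, y] = x⁻¹y⁻¹xy and x^y = y⁻¹xy. Consequently, multiplying [a⁻¹wa, b] on the right by b⁻¹ yields ((b⁻¹)^w)^a = (b^{-w})^a, a conjugate of the known element b^{-w} = (b⁻¹)^w by the unknown a. -/
/-- Commutator identity attacking the subgroup-restricted conjugacy search problem:
if `a * b = b * a` then `[a⁻¹*w*a, b] = ((b⁻¹)^w)^a * b`, where `[x,y] = x⁻¹y⁻¹xy`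
and `x^y = y⁻¹xy`. -/
theorem commutator_attacks_conjugacy {G : Type*} [Group G] (a b w : G)
    (h : a * b = b * a) :
    (a⁻¹ * w * a)⁻¹ * b⁻¹ * (a⁻¹ * w * a) * b =
      (a⁻¹ * (w⁻¹ * b⁻¹ * w) * a) * b := by
  have hb : a * b⁻¹ * a⁻¹ = b⁻¹ := by
    rw [mul_inv_eq_iff_eq_mul]
    exact (show Commute a b from h).inv_right.eq
  calc (a⁻¹ * w * a)⁻¹ * b⁻¹ * (a⁻¹ * w * a) * b
      = a⁻¹ * (w⁻¹ * (a * b⁻¹ * a⁻¹) * w) * a * b := by group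
    _ = (a⁻¹ * (w⁻¹ * b⁻¹ * w) * a) * b := by rw [hb]
end
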